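/- Let N ≥ 2, c > 0, strictly sorted channel gains 0 < h_1 < h_2 < … < h_N, P_max > 0, and R̄_1, …, R̄_N ≥ 0, and suppose the feasible set {p ≥ 0 : Σ_i p_i ≤ P_max, R_i(p) ≥ R̄_i ∀i} is nonempty. Then any maximizer p of the sum-rate f(p) = Σ_{i=1}^{N} R_i(p) over this feasible set satisfies the minimum-rate constraints of the first N−1 (weaker) users with equality: R_i(p) = R̄_i for all i = 1, …, N−1. -/

import Mathlib

open Finset

/-- Cumulative power `a_i = Σ_{l=i}^{N} p_l` (so `a_{N+1} = 0`). -/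
noncomputable def cumPow (N : ℕ) (p : ℕ → ℝ) (i : ℕ) : ℝ := ∑ l ∈ Finset.Icc i N, p l

/-- Per-user SIC rate `R_i(p) = log₂((hᵢ²·aᵢ(p) + c)/(hᵢ²·a_{i+1}(p) + c))`. -/
noncomputable def rate (N : ℕ) (h : ℕ → ℝ) (c : ℝ) (p : ℕ → ℝ) (i : ℕ) : ℝ :=
  Real.logb 2 (((h i) ^ 2 * cumPow N p i + c) / ((h i) ^ 2 * cumPow N p (i + 1) + c))

/-- Per-beam sum rate `f(p) = Σ_{i=1}^{N} R_i(p)`. -/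
noncomputable def sumRate (N : ℕ) (h : ℕ → ℝ) (c : ℝ) (p : ℕ → ℝ) : ℝ :=
  ∑ i ∈ Finset.Icc 1 N, rate N h c p i

/-- Move power `ε` from user `k` to user `k + 1`. -/
noncomputable def shiftPow (p : ℕ → ℝ) (k : ℕ) (ε : ℝ) (l : ℕ) : ℝ :=
  p l + ((if l = k + 1 then ε else 0) - (if l = k then ε else 0))

theorem cumPow_shiftPow {N k : ℕ} (hk : k + 1 ≤ N) (p : ℕ → ℝ) (ε : ℝ) (i : ℕ) :
    cumPow N (shiftPow p k ε) i = cumPow N p i + if i = k + 1 then ε else 0 := by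
  simp only [cumPow, shiftPow, Finset.sum_add_distrib, Finset.sum_sub_distrib,
    Finset.sum_ite_eq', Finset.mem_Icc]
  congr 1
  split_ifs <;> first | omega | simp

theorem cumPow_eq_add {N k : ℕ} (hk : k ≤ N) (p : ℕ → ℝ) :
    cumPow N p k = p k + cumPow N p (k + 1) := by
  simp only [cumPow]
  rw [← Finset.insert_Icc_add_one_left_eq_Icc hk, Finset.sum_insert (by simp)]

theorem cumPow_nonneg {N : ℕ} {p : ℕ → ℝ} (hp : ∀ i ∈ Finset.Icc 1 N, 0 ≤ p i)
    {i : ℕ} (hi : 1 ≤ i) : 0 ≤ cumPow N p i :=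
  Finset.sum_nonneg fun l hl => hp l (by simp only [Finset.mem_Icc] at hl ⊢; omega)

theorem rate_shiftPow_of_ne {N k : ℕ} (hk : k + 1 ≤ N) (h : ℕ → ℝ) (c : ℝ) (p : ℕ → ℝ) (ε : ℝ)
    {i : ℕ} (hik : i ≠ k) (hik' : i ≠ k + 1) :
    rate N h c (shiftPow p k ε) i = rate N h c p i := by
  simp [rate, cumPow_shiftPow hk, hik, hik']

theorem rate_shiftPow_self {N k : ℕ} (hk : k + 1 ≤ N) (h : ℕ → ℝ) (c : ℝ) (p : ℕ → ℝ) (ε : ℝ) :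
    rate N h c (shiftPow p k ε) k =
      Real.logb 2 ((h k ^ 2 * cumPow N p k + c) / (h k ^ 2 * (cumPow N p (k + 1) + ε) + c)) := by
  simp [rate, cumPow_shiftPow hk]

theorem rate_shiftPow_succ {N k : ℕ} (hk : k + 1 ≤ N) (h : ℕ → ℝ) (c : ℝ) (p : ℕ → ℝ) (ε : ℝ) :
    rate N h c (shiftPow p k ε) (k + 1) =
      Real.logb 2 ((h (k + 1) ^ 2 * (cumPow N p (k + 1) + ε) + c) /
        (h (k + 1) ^ 2 * cumPow N p (k + 1 + 1) + c)) := by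
  simp [rate, cumPow_shiftPow hk]

/-- With a larger gain `H > g`, the two-user sum rate strictly increases with the power `x`
at the boundary between the users. -/
theorem logb_div_add_logb_div_lt {g H c x ε A B : ℝ} (hg : 0 ≤ g) (hgH : g < H) (hc : 0 < c)
    (hx : 0 ≤ x) (hε : 0 < ε) (hA : 0 < A) (hB : 0 < B) :
    Real.logb 2 (A / (g * x + c)) + Real.logb 2 ((H * x + c) / B) <
      Real.logb 2 (A / (g * (x + ε) + c)) + Real.logb 2 ((H * (x + ε) + c) / B) := by
  have hH : 0 < H := hg.trans_lt hgH
  have h1 : 0 < g * x + c := by positivity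
  have h2 : 0 < H * x + c := by positivity
  have h3 : 0 < g * (x + ε) + c := by positivity
  have h4 : 0 < H * (x + ε) + c := by positivity
  have key : Real.logb 2 ((H * x + c) * (g * (x + ε) + c)) <
      Real.logb 2 ((H * (x + ε) + c) * (g * x + c)) := by
    apply Real.logb_lt_logb one_lt_two (by positivity)
    nlinarith [mul_pos (mul_pos hε hc) (sub_pos.2 hgH)]
  rw [Real.logb_mul h2.ne' h3.ne', Real.logb_mul h4.ne' h1.ne'] at key
  rw [Real.logb_div hA.ne' h1.ne', Real.logb_div h2.ne' hB.ne', Real.logb_div hA.ne' h3.ne',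
    Real.logb_div h4.ne' hB.ne']
  linarith

theorem rate_add_rate_lt_shiftPow {N k : ℕ} (hk1 : 1 ≤ k) (hk : k + 1 ≤ N) {h : ℕ → ℝ} {c : ℝ}
    (hc : 0 < c) (hhk : 0 < h k) (hlt : h k < h (k + 1)) {p : ℕ → ℝ}
    (hp : ∀ i ∈ Finset.Icc 1 N, 0 ≤ p i) {ε : ℝ} (hε : 0 < ε) :
    rate N h c p k + rate N h c p (k + 1) <
      rate N h c (shiftPow p k ε) k + rate N h c (shiftPow p k ε) (k + 1) := by
  rw [rate_shiftPow_self hk, rate_shiftPow_succ hk]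
  have h0 := cumPow_nonneg hp hk1
  have h1 := cumPow_nonneg hp (i := k + 1) (by omega)
  have h2 := cumPow_nonneg hp (i := k + 1 + 1) (by omega)
  exact logb_div_add_logb_div_lt (by positivity) (by gcongr) hc h1 hε (by positivity)
    (by positivity)

theorem sumRate_lt_shiftPow {N k : ℕ} (hk1 : 1 ≤ k) (hk : k + 1 ≤ N) {h : ℕ → ℝ} {c : ℝ}
    (hc : 0 < c) (hhk : 0 < h k) (hlt : h k < h (k + 1)) {p : ℕ → ℝ}
    (hp : ∀ i ∈ Finset.Icc 1 N, 0 ≤ p i) {ε : ℝ} (hε : 0 < ε) :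
    sumRate N h c p < sumRate N h c (shiftPow p k ε) := by
  rw [← sub_pos, sumRate, sumRate, ← Finset.sum_sub_distrib,
    Finset.sum_eq_add_of_mem k (k + 1) (by simp; omega) (by simp; omega) (by omega)
      fun i _ hi => by rw [rate_shiftPow_of_ne hk h c p ε hi.1 hi.2, sub_self]]
  linarith [rate_add_rate_lt_shiftPow hk1 hk hc hhk hlt hp hε]

theorem rate_le_rate_shiftPow_succ {N k : ℕ} (hk : k + 1 ≤ N) {h : ℕ → ℝ} {c : ℝ}
    (hc : 0 < c) {p : ℕ → ℝ} (hp : ∀ i ∈ Finset.Icc 1 N, 0 ≤ p i) {ε : ℝ} (hε : 0 ≤ ε) :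
    rate N h c p (k + 1) ≤ rate N h c (shiftPow p k ε) (k + 1) := by
  have h1 := cumPow_nonneg hp (i := k + 1) (by omega)
  have h2 := cumPow_nonneg hp (i := k + 1 + 1) (by omega)
  rw [rate_shiftPow_succ hk, rate]
  apply Real.logb_le_logb_of_le one_lt_two (by positivity)
  gcongr
  linarith

theorem pos_of_rate_pos {N k : ℕ} (hk1 : 1 ≤ k) (hk : k ≤ N) {h : ℕ → ℝ} {c : ℝ}
    (hc : 0 < c) {p : ℕ → ℝ} (hp : ∀ i ∈ Finset.Icc 1 N, 0 ≤ p i)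
    (hr : 0 < rate N h c p k) : 0 < p k := by
  refine (hp k (Finset.mem_Icc.2 ⟨hk1, hk⟩)).lt_of_ne fun h0 => hr.ne' ?_
  have h1 := cumPow_nonneg hp (i := k + 1) (by omega)
  have h2 : 0 < h k ^ 2 * cumPow N p (k + 1) + c := by positivity
  rw [rate, cumPow_eq_add hk, ← h0, zero_add, div_self h2.ne', Real.logb_one]

theorem continuousAt_rate_shiftPow_self {N k : ℕ} (hk1 : 1 ≤ k) (hk : k + 1 ≤ N) {h : ℕ → ℝ}
    {c : ℝ} (hc : 0 < c) {p : ℕ → ℝ} (hp : ∀ i ∈ Finset.Icc 1 N, 0 ≤ p i) :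
    ContinuousAt (fun ε => rate N h c (shiftPow p k ε) k) 0 := by
  simp only [rate_shiftPow_self hk, Real.logb]
  have h0 := cumPow_nonneg hp hk1
  have h1 := cumPow_nonneg hp (i := k + 1) (by omega)
  have hA : 0 < h k ^ 2 * cumPow N p k + c := by positivity
  have hB : 0 < h k ^ 2 * (cumPow N p (k + 1) + 0) + c := by positivity
  apply ContinuousAt.div_const
  apply ContinuousAt.log
  · apply ContinuousAt.div
    · fun_prop
    · fun_prop
    · exact hB.ne'
  · exact (div_pos hA hB).ne'

/-- with strictly sorted channel gains, any maximizer of the sum rate over the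
feasible set meets the minimum-rate constraints of the first `N−1` (weaker) users with
equality: `R_i(p) = R̄_i` for `i = 1, …, N−1`. -/
theorem maximizer_saturates_weak_users_constraints
    (N : ℕ) (hN : 2 ≤ N) (h : ℕ → ℝ) (c : ℝ) (hc : 0 < c)
    (hh : ∀ i ∈ Finset.Icc 1 N, 0 < h i)
    (hsort : ∀ i ∈ Finset.Icc 1 N, ∀ j ∈ Finset.Icc 1 N, i < j → h i < h j)
    (Pmax : ℝ) (hP : 0 < Pmax) (Rbar : ℕ → ℝ)
    (hR : ∀ i ∈ Finset.Icc 1 N, 0 ≤ Rbar i)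
    (p : ℕ → ℝ)
    (hmem : p ∈ {q : ℕ → ℝ | (∀ i ∈ Finset.Icc 1 N, 0 ≤ q i) ∧
        (∑ i ∈ Finset.Icc 1 N, q i ≤ Pmax) ∧
        (∀ i ∈ Finset.Icc 1 N, rate N h c q i ≥ Rbar i)})
    (hmax : IsMaxOn (sumRate N h c)
        {q : ℕ → ℝ | (∀ i ∈ Finset.Icc 1 N, 0 ≤ q i) ∧
          (∑ i ∈ Finset.Icc 1 N, q i ≤ Pmax) ∧
          (∀ i ∈ Finset.Icc 1 N, rate N h c q i ≥ Rbar i)} p) :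
    ∀ i ∈ Finset.Icc 1 (N - 1), rate N h c p i = Rbar i := by
  obtain ⟨hp, hsum, hrate⟩ := hmem
  intro k hk
  rw [Finset.mem_Icc] at hk
  have hk1 : 1 ≤ k := hk.1
  have hkN : k + 1 ≤ N := by omega
  have hkmem : k ∈ Finset.Icc 1 N := Finset.mem_Icc.2 ⟨hk1, by omega⟩
  have hkmem' : k + 1 ∈ Finset.Icc 1 N := Finset.mem_Icc.2 ⟨by omega, hkN⟩
  by_contra hne
  have hgt : Rbar k < rate N h c p k := lt_of_le_of_ne (hrate k hkmem) (Ne.symm hne)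
  have hpk : 0 < p k := pos_of_rate_pos hk1 (by omega) hc hp ((hR k hkmem).trans_lt hgt)
  have hev : ∀ᶠ ε in nhds (0 : ℝ), Rbar k < rate N h c (shiftPow p k ε) k :=
    (continuousAt_rate_shiftPow_self hk1 hkN hc hp).eventually
      (lt_mem_nhds (by simpa [shiftPow, rate, cumPow] using hgt))
  obtain ⟨ε, ⟨hεR, hεp⟩, hε⟩ := (((hev.and (gt_mem_nhds hpk)).filter_mono
    nhdsWithin_le_nhds).and (self_mem_nhdsWithin (s := Set.Ioi (0 : ℝ)))).exists
  refine absurd (hmax (a := shiftPow p k ε) ⟨fun i hi => ?_, ?_, fun i hi => ?_⟩)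
    (not_le.2 (sumRate_lt_shiftPow hk1 hkN hc (hh k hkmem)
      (hsort k hkmem (k + 1) hkmem' k.lt_succ_self) hp hε))
  · have := hp i hi
    unfold shiftPow
    split_ifs with h1 h2 h2
    · omega
    · linarith
    · subst h2; linarith
    · linarith
  · have := cumPow_shiftPow hkN p ε 1
    rw [if_neg (by omega), add_zero] at this
    exact this.trans_le hsum
  · by_cases h1 : i = k
    · subst h1; exact hεR.le
    by_cases h2 : i = k + 1
    · subst h2; exact (hrate _ hi).trans (rate_le_rate_shiftPow_succ hkN hc hp hε.le)
    · rw [rate_shiftPow_of_ne hkN h c p ε h1 h2]; exact hrate i hi
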